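/- arXiv:2204.03603 — 4 statements merged into one kernel-verified Lean document; each statement's English description precedes it below -/
import Mathlib

section
/- Suppose A is lower triangular (a DIRK scheme). Then for every integer m ≥ 1, dim(K_m) ≥ min{⌊(m + κ)/2⌋, n_c} − κ, where κ = 1 if the scheme is a GEDIRK and κ = 0 otherwise. -/
open Matrix Polynomial

noncomputable section

/-- The all-ones vector `e = (1,...,1)ᵀ ∈ ℝˢ`. -/
def ones (s : ℕ) : Fin s → ℝ := fun _ => 1

/-- The abscissa vector `c := A·e`. -/
def cvec {s : ℕ} (A : Matrix (Fin s) (Fin s) ℝ) : Fin s → ℝ := A.mulVec (ones s)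

/-- The stage order residual `τ^(k) := A·c^{k−1} − (1/k)·c^k` (componentwise powers). -/
def tauvec {s : ℕ} (A : Matrix (Fin s) (Fin s) ℝ) (k : ℕ) : Fin s → ℝ :=
  A.mulVec (fun i => cvec A i ^ (k - 1)) - (1 / (k : ℝ)) • fun i => cvec A i ^ k

/-- `K_m := span{ Aʲ τ^(k) : 0 ≤ j ≤ s−1, 1 ≤ k ≤ m }`. -/
def Kspace {s : ℕ} (A : Matrix (Fin s) (Fin s) ℝ) (m : ℕ) : Submodule ℝ (Fin s → ℝ) :=
  Submodule.span ℝ {v | ∃ j k : ℕ, j < s ∧ 1 ≤ k ∧ k ≤ m ∧ v = (A ^ j).mulVec (tauvec A k)}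

/-- `Y := span{ (Aᵀ)ʲ b : 0 ≤ j ≤ s−1 }`. -/
def Yspace {s : ℕ} (A : Matrix (Fin s) (Fin s) ℝ) (b : Fin s → ℝ) : Submodule ℝ (Fin s → ℝ) :=
  Submodule.span ℝ {v | ∃ j : ℕ, j < s ∧ v = (A.transpose ^ j).mulVec b}

/-- Weak stage order at least `q`: `bᵀ Aʲ τ^(k) = 0` for `0 ≤ j ≤ s−1`, `1 ≤ k ≤ q`. -/
def WSO {s : ℕ} (A : Matrix (Fin s) (Fin s) ℝ) (b : Fin s → ℝ) (q : ℕ) : Prop :=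
  ∀ j k : ℕ, j < s → 1 ≤ k → k ≤ q → b ⬝ᵥ (A ^ j).mulVec (tauvec A k) = 0

/-- `n_c`: the number of distinct abscissas, i.e. distinct entries of `c`. -/
def numAbscissas {s : ℕ} (A : Matrix (Fin s) (Fin s) ℝ) : ℕ :=
  (Finset.univ.image (cvec A)).card


/-- The scheme is stiffly accurate: the last row of `A` equals `bᵀ`. -/
def StifflyAccurate {s : ℕ} (hs : 0 < s) (A : Matrix (Fin s) (Fin s) ℝ) (b : Fin s → ℝ) : Prop :=
  ∀ j, A ⟨s - 1, Nat.sub_lt hs Nat.one_pos⟩ j = b j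

/-- A DIRK scheme: `A` is lower triangular. -/
def LowerTriangular {s : ℕ} (A : Matrix (Fin s) (Fin s) ℝ) : Prop :=
  ∀ i j : Fin s, i < j → A i j = 0

/-- A GEDIRK: `c` has a zero entry, and `a_{ℓℓ} = 0` where `ℓ` is the smallest index with `c_ℓ = 0`. -/
def GEDIRK {s : ℕ} (A : Matrix (Fin s) (Fin s) ℝ) : Prop :=
  ∃ l : Fin s, cvec A l = 0 ∧ (∀ j : Fin s, j < l → cvec A j ≠ 0) ∧ A l l = 0

/-- `QProp A b Q`: `Q` is monic, `bᵀ Q(A) = 0`, and `Q` has minimal degree among such monic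
polynomials. -/
def QProp {s : ℕ} (A : Matrix (Fin s) (Fin s) ℝ) (b : Fin s → ℝ) (Q : Polynomial ℝ) : Prop :=
  Q.Monic ∧ b ᵥ* (aeval A Q) = 0 ∧
    ∀ R : Polynomial ℝ, R.Monic → b ᵥ* (aeval A R) = 0 → Q.degree ≤ R.degree

/-- `PProp A q P`: `P` is monic, `P(A)·τ^(k) = 0` for `k = 2,…,q`, and `P` has minimal degree
among such monic polynomials. -/
def PProp {s : ℕ} (A : Matrix (Fin s) (Fin s) ℝ) (q : ℕ) (P : Polynomial ℝ) : Prop :=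
  P.Monic ∧ (∀ k : ℕ, 2 ≤ k → k ≤ q → (aeval A P).mulVec (tauvec A k) = 0) ∧
    ∀ R : Polynomial ℝ, R.Monic →
      (∀ k : ℕ, 2 ≤ k → k ≤ q → (aeval A R).mulVec (tauvec A k) = 0) → P.degree ≤ R.degree

section LaguerreMoments

open MeasureTheory Set

theorem integrableOn_pow_mul_exp_neg (n : ℕ) :
    IntegrableOn (fun x : ℝ => x ^ n * Real.exp (-x)) (Ioi 0) := by
  have h := Real.GammaIntegral_convergent (s := (n : ℝ) + 1) (by positivity)
  refine h.congr_fun (fun x _ => ?_) measurableSet_Ioi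
  simp [mul_comm]

theorem integral_pow_mul_exp_neg (n : ℕ) :
    ∫ x in Ioi (0 : ℝ), x ^ n * Real.exp (-x) = n.factorial := by
  rw [← Real.Gamma_nat_eq_factorial, Real.Gamma_eq_integral (by positivity)]
  refine setIntegral_congr_fun measurableSet_Ioi (fun x _ => ?_)
  simp [mul_comm]

theorem pow_mul_eval_mul_exp_neg_eq_sum (t : ℕ) (a : ℝ) (p : ℝ[X]) (x : ℝ) :
    x ^ t * p.eval (a * x) * Real.exp (-x) = ∑ k ∈ Finset.range (p.natDegree + 1),
      p.coeff k * a ^ k * (x ^ (k + t) * Real.exp (-x)) := by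
  rw [eval_eq_sum_range, Finset.mul_sum, Finset.sum_mul]
  refine Finset.sum_congr rfl fun k _ => ?_
  ring

theorem integrableOn_pow_mul_eval_mul_exp_neg (t : ℕ) (a : ℝ) (p : ℝ[X]) :
    IntegrableOn (fun x : ℝ => x ^ t * p.eval (a * x) * Real.exp (-x)) (Ioi 0) := by
  simp_rw [pow_mul_eval_mul_exp_neg_eq_sum]
  exact integrable_finsetSum _ fun k _ => (integrableOn_pow_mul_exp_neg (k + t)).const_mul _

theorem integral_pow_mul_eval_mul_exp_neg (t : ℕ) (a : ℝ) (p : ℝ[X]) :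
    ∫ x in Ioi (0 : ℝ), x ^ t * p.eval (a * x) * Real.exp (-x) =
      ∑ k ∈ Finset.range (p.natDegree + 1), p.coeff k * a ^ k * (k + t).factorial := by
  simp_rw [pow_mul_eval_mul_exp_neg_eq_sum]
  rw [integral_finsetSum _ fun k _ => (integrableOn_pow_mul_exp_neg (k + t)).const_mul _]
  simp_rw [integral_const_mul, integral_pow_mul_exp_neg]

/-- The moment functional `X ^ k ↦ a ^ k * (k + t)!` is positive on squares. -/
theorem sum_coeff_sq_mul_factorial_pos (t : ℕ) (a : ℝ) (p : ℝ[X])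
    (hp : p.comp (C a * X) ≠ 0) :
    0 < ∑ k ∈ Finset.range ((p ^ 2).natDegree + 1),
      (p ^ 2).coeff k * a ^ k * (k + t).factorial := by
  rw [← integral_pow_mul_eval_mul_exp_neg, setIntegral_pos_iff_support_of_nonneg_ae]
  · refine lt_of_lt_of_le (b := volume (Ioi (0 : ℝ) \ {x | (p.comp (C a * X)).IsRoot x})) ?_
      (measure_mono ?_)
    · rw [measure_sdiff_null ((finite_setOfPred_isRoot hp).measure_zero _)]
      simp
    · rintro x ⟨hx, hx'⟩
      have hx0 : (0 : ℝ) < x := hx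
      have hx1 : p.eval (a * x) ≠ 0 := by simpa using hx'
      refine ⟨?_, hx⟩
      simp only [Function.mem_support, eval_pow]
      positivity
  · filter_upwards [ae_restrict_mem measurableSet_Ioi] with x hx
    have hx0 : (0 : ℝ) < x := hx
    simp only [Pi.zero_apply, eval_pow]
    positivity
  · exact integrableOn_pow_mul_eval_mul_exp_neg t a (p ^ 2)

end LaguerreMoments

/-- The vector of values `p(c_j)` of a polynomial `p` at the entries of `c`. -/
def polyVec {s : ℕ} (c : Fin s → ℝ) : ℝ[X] →ₗ[ℝ] (Fin s → ℝ) :=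
  LinearMap.pi fun j => leval (c j)

@[simp]
theorem polyVec_apply {s : ℕ} (c : Fin s → ℝ) (p : ℝ[X]) (j : Fin s) :
    polyVec c p j = p.eval (c j) := rfl

/-- The vectors whose first `i` entries vanish. -/
def tailSpace (s i : ℕ) : Submodule ℝ (Fin s → ℝ) where
  carrier := {v | ∀ j : Fin s, (j : ℕ) < i → v j = 0}
  add_mem' hv hw j hj := by simp [hv j hj, hw j hj]
  zero_mem' _ _ := rfl
  smul_mem' a v hv j hj := by simp [hv j hj]

theorem tailSpace_zero (s : ℕ) : tailSpace s 0 = ⊤ :=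
  eq_top_iff.2 fun _ _ _ hj => absurd hj (Nat.not_lt_zero _)

theorem LowerTriangular.mulVec_sub_smul_mem_tailSpace {s : ℕ}
    {A : Matrix (Fin s) (Fin s) ℝ} (hA : LowerTriangular A) (i : Fin s) {v : Fin s → ℝ}
    (hv : v ∈ tailSpace s i) : A *ᵥ v - A i i • v ∈ tailSpace s (i + 1) := by
  intro j hj
  have hsum : (A *ᵥ v) j = A j i * v i := by
    rw [mulVec, dotProduct]
    refine Finset.sum_eq_single i (fun k _ hk => ?_) (fun h => absurd (Finset.mem_univ i) h)
    rcases lt_or_gt_of_ne hk with h | h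
    · rw [hv k h, mul_zero]
    · rw [hA j k (lt_of_le_of_lt (Fin.le_def.2 (by omega)) h), zero_mul]
  rcases (Nat.lt_succ_iff.1 hj).lt_or_eq with h | h
  · simp [hsum, hv j h, hA j i h]
  · obtain rfl : j = i := Fin.ext h
    simp [hsum]

/-- If `K` is `A`-invariant and contains the first `m` stage order residuals, and if the vectors
`c^t r(c)` lie in `K` up to entries of index at least `i`, then they do so up to entries of index
greater than `i`, provided that `m` is large compared with the number of nodes seen so far. -/
theorem polyVec_X_pow_mul_mem_sup_tailSpace_succ {s : ℕ} {A : Matrix (Fin s) (Fin s) ℝ}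
    (hA : LowerTriangular A) {m : ℕ} {K : Submodule ℝ (Fin s → ℝ)}
    (hinv : ∀ v ∈ K, A *ᵥ v ∈ K) (hτ : ∀ k, 1 ≤ k → k ≤ m → tauvec A k ∈ K)
    (t : ℕ) (i : Fin s) (S : Finset ℝ)
    (hS : ∀ j ≤ i, cvec A j ∈ S ∨ (t ≠ 0 ∧ cvec A j = 0))
    (hm : 2 * S.card + t ≤ m) (hi : A i i ≠ 0 ∨ 0 ∉ S)
    (ih : ∀ r, polyVec (cvec A) (X ^ t * r) ∈ K ⊔ tailSpace s i) (r : ℝ[X]) :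
    polyVec (cvec A) (X ^ t * r) ∈ K ⊔ tailSpace s (i + 1) := by
  by_contra hr
  obtain ⟨φ, hφr, hφ⟩ := Submodule.exists_le_ker_of_notMem hr
  have hφK : ∀ v ∈ K, φ v = 0 := fun v hv => hφ (Submodule.mem_sup_left hv)
  have hφZ : ∀ v ∈ tailSpace s (i + 1), φ v = 0 := fun v hv => hφ (Submodule.mem_sup_right hv)
  have heig : ∀ v ∈ K ⊔ tailSpace s i, φ (A *ᵥ v) = A i i * φ v := by
    intro v hv
    obtain ⟨k, hk, z, hz, rfl⟩ := Submodule.mem_sup.1 hv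
    have h1 := hφZ _ (hA.mulVec_sub_smul_mem_tailSpace i hz)
    rw [map_sub, map_smul, smul_eq_mul, sub_eq_zero] at h1
    rw [mulVec_add, map_add, map_add, hφK _ (hinv k hk), hφK k hk, h1, zero_add, zero_add]
  have hrec : ∀ k, k + t + 1 ≤ m → φ (polyVec (cvec A) (X ^ (k + t + 1))) =
      (k + t + 1 : ℝ) * A i i * φ (polyVec (cvec A) (X ^ (k + t))) := by
    intro k hk
    have h1 := hφK _ (hτ (k + t + 1) (by omega) hk)
    have h2 : tauvec A (k + t + 1) = A *ᵥ polyVec (cvec A) (X ^ (k + t)) -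
        (1 / ((k + t + 1 : ℕ) : ℝ)) • polyVec (cvec A) (X ^ (k + t + 1)) := by
      have e1 : polyVec (cvec A) (X ^ (k + t)) = fun j => cvec A j ^ (k + t) := by
        ext j; simp
      have e2 : polyVec (cvec A) (X ^ (k + t + 1)) = fun j => cvec A j ^ (k + t + 1) := by
        ext j; simp
      rw [e1, e2, tauvec, Nat.add_sub_cancel]
    have h3 := ih (X ^ k)
    rw [← pow_add, add_comm t k] at h3
    rw [h2, map_sub, map_smul, smul_eq_mul, heig _ h3, sub_eq_zero] at h1
    have hpos : (k + t + 1 : ℝ) ≠ 0 := by positivity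
    push_cast at h1
    field_simp at h1
    linarith
  have hmom : ∀ k, k + t ≤ m → (t.factorial : ℝ) * φ (polyVec (cvec A) (X ^ (k + t))) =
      A i i ^ k * (k + t).factorial * φ (polyVec (cvec A) (X ^ t)) := by
    intro k
    induction k with
    | zero => intro _; simp
    | succ k hk =>
      intro h
      have e : k + 1 + t = k + t + 1 := by ring
      rw [e, hrec k (by omega), Nat.factorial_succ]
      push_cast
      linear_combination (k + t + 1 : ℝ) * A i i * hk (by omega)
  have hmomp : ∀ p : ℝ[X], p.natDegree + t ≤ m →
      (t.factorial : ℝ) * φ (polyVec (cvec A) (X ^ t * p)) =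
      (∑ k ∈ Finset.range (p.natDegree + 1), p.coeff k * A i i ^ k * (k + t).factorial) *
        φ (polyVec (cvec A) (X ^ t)) := by
    intro p hp
    have e : X ^ t * p = ∑ k ∈ Finset.range (p.natDegree + 1), p.coeff k • X ^ (k + t) := by
      conv_lhs => rw [p.as_sum_range_C_mul_X_pow, Finset.mul_sum]
      refine Finset.sum_congr rfl fun k _ => ?_
      rw [smul_eq_C_mul]
      ring
    rw [e, map_sum, map_sum, Finset.mul_sum, Finset.sum_mul]
    refine Finset.sum_congr rfl fun k hk => ?_
    have hk' := Finset.mem_range.1 hk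
    rw [map_smul, map_smul, smul_eq_mul]
    linear_combination p.coeff k * hmom k (by omega)
  have ht : (t.factorial : ℝ) ≠ 0 := by positivity
  set Q : ℝ[X] := ∏ a ∈ S, (X - C a) with hQ
  have hQmonic : Q.Monic := monic_prod_X_sub_C _ _
  have hQdeg : Q.natDegree = S.card := natDegree_finsetProd_X_sub_C_eq_card S _
  have hvanish : ∀ p, φ (polyVec (cvec A) (X ^ t * (Q * p))) = 0 := by
    refine fun p => hφZ _ fun j hj => ?_
    rcases hS j (Fin.le_def.2 (by omega)) with h | ⟨h, h'⟩
    · have : Q.eval (cvec A j) = 0 := by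
        rw [hQ, eval_prod]
        exact Finset.prod_eq_zero h (by simp)
      simp [this]
    · simp [h, h']
  have hcomp : Q.comp (C (A i i) * X) ≠ 0 := by
    rcases hi with h | h
    · intro h0
      apply hQmonic.ne_zero
      ext k
      have := congrArg (fun p => coeff p k) h0
      simpa [comp_C_mul_X_coeff, h] using this
    · intro h0
      have := congrArg (eval 0) h0
      simp only [eval_comp, eval_mul, eval_X, mul_zero, eval_zero, hQ, eval_prod,
        Finset.prod_eq_zero_iff] at this
      obtain ⟨a, ha, h'⟩ := this
      rw [eval_sub, eval_X, eval_C, zero_sub, neg_eq_zero] at h'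
      exact h (h' ▸ ha)
  have hM : φ (polyVec (cvec A) (X ^ t)) = 0 := by
    have hdeg : (Q ^ 2).natDegree = 2 * S.card := by rw [natDegree_pow, hQdeg]
    have h1 := hmomp (Q ^ 2) (by omega)
    rw [pow_two, hvanish, mul_zero, ← pow_two] at h1
    exact (mul_eq_zero.1 h1.symm).resolve_left
      (sum_coeff_sq_mul_factorial_pos t (A i i) Q hcomp).ne'
  apply hφr
  rw [← modByMonic_add_div r Q, mul_add, map_add, map_add, hvanish, add_zero]
  have h1 := hmomp (r %ₘ Q) (by
    have := natDegree_modByMonic_le r hQmonic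
    omega)
  rw [hM, mul_zero] at h1
  exact (mul_eq_zero.1 h1).resolve_left ht

/-- If the vectors `c^t r(c)` lie in `K` up to entries of index at least `i`, then there are at
most `dim K` distinct (nonzero, if `t ≠ 0`) entries of `c` of index less than `i`. -/
theorem card_le_finrank_of_polyVec_mem {s : ℕ} {c : Fin s → ℝ} {K : Submodule ℝ (Fin s → ℝ)}
    {t i : ℕ} (h : ∀ r, polyVec c (X ^ t * r) ∈ K ⊔ tailSpace s i) (T : Finset ℝ)
    (hT : ∀ a ∈ T, ∃ j : Fin s, (j : ℕ) < i ∧ c j = a) (h0 : t = 0 ∨ (0 : ℝ) ∉ T) :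
    T.card ≤ Module.finrank ℝ K := by
  choose J hJi hJ using fun a : T => hT a a.2
  let f : K →ₗ[ℝ] (T → ℝ) := (LinearMap.funLeft ℝ ℝ J).comp K.subtype
  have hf : Function.Surjective f := by
    intro g
    obtain ⟨k, hk, z, hz, hkz⟩ := Submodule.mem_sup.1
      (h (Lagrange.interpolate Finset.univ (fun a : T => (a : ℝ)) fun a => g a / (a : ℝ) ^ t))
    refine ⟨⟨k, hk⟩, funext fun a => ?_⟩
    have h1 := congrFun hkz (J a)
    have ha : (a : ℝ) ^ t ≠ 0 := by
      rcases h0 with rfl | h0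
      · simp
      · exact pow_ne_zero _ fun h' => h0 (h' ▸ a.2)
    rw [Pi.add_apply, hz _ (hJi a), add_zero, polyVec_apply, eval_mul, eval_pow, eval_X, hJ a,
      Lagrange.eval_interpolate_at_node _ Subtype.val_injective.injOn (Finset.mem_univ a),
      mul_div_cancel₀ _ ha] at h1
    exact h1
  simpa using LinearMap.finrank_le_finrank_of_surjective hf

theorem tauvec_mem_Kspace {s : ℕ} (A : Matrix (Fin s) (Fin s) ℝ) {m k : ℕ} (h1 : 1 ≤ k)
    (hk : k ≤ m) : tauvec A k ∈ Kspace A m := by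
  rcases Nat.eq_zero_or_pos s with rfl | hs
  · rw [Subsingleton.elim (tauvec A k) 0]
    exact zero_mem _
  · exact Submodule.subset_span ⟨0, k, hs, h1, hk, by simp⟩

theorem mulVec_mem_Kspace {s : ℕ} (A : Matrix (Fin s) (Fin s) ℝ) (m : ℕ) {v : Fin s → ℝ}
    (hv : v ∈ Kspace A m) : A *ᵥ v ∈ Kspace A m := by
  suffices Kspace A m ≤ (Kspace A m).comap A.mulVecLin from this hv
  refine Submodule.span_le.2 ?_
  rintro _ ⟨j, k, hj, h1, hk, rfl⟩
  have hs : 0 < s := by omega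
  change A *ᵥ (A ^ j *ᵥ tauvec A k) ∈ Kspace A m
  have hne : A.charpoly ≠ 1 := by
    intro h
    have := congrArg natDegree h
    simp at this
    omega
  have hdeg := natDegree_modByMonic_lt (X ^ (j + 1)) A.charpoly_monic hne
  rw [charpoly_natDegree_eq_dim, Fintype.card_fin] at hdeg
  rw [mulVec_mulVec, ← pow_succ', pow_eq_aeval_mod_charpoly, aeval_eq_sum_range' hdeg, sum_mulVec]
  refine Submodule.sum_mem _ fun l hl => ?_
  rw [smul_mulVec]
  exact Submodule.smul_mem _ _
    (Submodule.subset_span ⟨l, k, Finset.mem_range.1 hl, h1, hk, rfl⟩)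

/-- The distinct entries of `c` of index less than `i`. -/
def headNodes {s : ℕ} (c : Fin s → ℝ) (i : ℕ) : Finset ℝ :=
  (Finset.univ.filter fun j : Fin s => (j : ℕ) < i).image c

theorem mem_headNodes {s : ℕ} {c : Fin s → ℝ} {i : ℕ} {a : ℝ} :
    a ∈ headNodes c i ↔ ∃ j : Fin s, (j : ℕ) < i ∧ c j = a := by
  simp [headNodes]

theorem headNodes_succ_subset {s : ℕ} (c : Fin s → ℝ) (i : Fin s) :
    headNodes c (i + 1) ⊆ insert (c i) (headNodes c i) := by
  intro a ha
  obtain ⟨j, hj, rfl⟩ := mem_headNodes.1 ha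
  rcases (Nat.lt_succ_iff.1 hj).lt_or_eq with h | h
  · exact Finset.mem_insert_of_mem (mem_headNodes.2 ⟨j, h, rfl⟩)
  · rw [Fin.ext h]
    exact Finset.mem_insert_self _ _

theorem card_headNodes_succ_le {s : ℕ} (c : Fin s → ℝ) (i : Fin s) :
    (headNodes c (i + 1)).card ≤ (headNodes c i).card + 1 :=
  (Finset.card_le_card (headNodes_succ_subset c i)).trans (Finset.card_insert_le _ _)

theorem card_headNodes_succ_erase_le {s : ℕ} (c : Fin s → ℝ) (i : Fin s) (a : ℝ) :
    ((headNodes c (i + 1)).erase a).card ≤ ((headNodes c i).erase a).card + 1 := by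
  refine (Finset.card_le_card (t := insert (c i) ((headNodes c i).erase a)) ?_).trans
    (Finset.card_insert_le _ _)
  intro b hb
  have h1 := Finset.mem_erase.1 hb
  rcases Finset.mem_insert.1 (headNodes_succ_subset c i h1.2) with h | h
  · exact h ▸ Finset.mem_insert_self _ _
  · exact Finset.mem_insert_of_mem (Finset.mem_erase.2 ⟨h1.1, h⟩)

theorem headNodes_self {s : ℕ} (A : Matrix (Fin s) (Fin s) ℝ) :
    (headNodes (cvec A) s).card = numAbscissas A := by
  simp [headNodes, numAbscissas]

/-- `c r(c)` belongs to `K` up to entries of index at least `i`, once this holds at `i₀`, if the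
number of nonzero nodes is controlled along the way. -/
theorem polyVec_X_mul_mem_sup_tailSpace {s : ℕ} {A : Matrix (Fin s) (Fin s) ℝ}
    (hA : LowerTriangular A) {m N : ℕ} {K : Submodule ℝ (Fin s → ℝ)}
    (hinv : ∀ v ∈ K, A *ᵥ v ∈ K) (hτ : ∀ k, 1 ≤ k → k ≤ m → tauvec A k ∈ K)
    (hm : 2 * (N + 1) + 1 ≤ m) {i₀ : ℕ}
    (hcard : ∀ i, i₀ ≤ i → i ≤ s →
      (∀ r, polyVec (cvec A) (X ^ 1 * r) ∈ K ⊔ tailSpace s i) →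
      ((headNodes (cvec A) i).erase 0).card ≤ N)
    (hbase : ∀ r, polyVec (cvec A) (X ^ 1 * r) ∈ K ⊔ tailSpace s i₀) {i : ℕ} (hi₀ : i₀ ≤ i)
    (hi : i ≤ s) (r : ℝ[X]) : polyVec (cvec A) (X ^ 1 * r) ∈ K ⊔ tailSpace s i := by
  induction i, hi₀ using Nat.le_induction generalizing r with
  | base => exact hbase r
  | succ i hi₀ ih =>
    refine polyVec_X_pow_mul_mem_sup_tailSpace_succ hA hinv hτ 1 ⟨i, hi⟩
      ((headNodes (cvec A) (i + 1)).erase 0) (fun j hj => ?_) ?_ (Or.inr (by simp))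
      (ih (by omega)) r
    · by_cases h : cvec A j = 0
      · exact Or.inr ⟨one_ne_zero, h⟩
      · exact Or.inl (Finset.mem_erase.2
          ⟨h, mem_headNodes.2 ⟨j, Nat.lt_succ_of_le (Fin.le_def.1 hj), rfl⟩⟩)
    · have h1 := card_headNodes_succ_erase_le (cvec A) ⟨i, hi⟩ 0
      have h2 := hcard i hi₀ (by omega) (ih (by omega))
      simp only at h1
      omega

/-- Every `r(c)` belongs to `K` up to entries of index at least `i`, if no vanishing diagonal
entry of `A` of index less than `i` is at or after a zero node. -/
theorem polyVec_mem_sup_tailSpace {s : ℕ} {A : Matrix (Fin s) (Fin s) ℝ}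
    (hA : LowerTriangular A) {m : ℕ} {K : Submodule ℝ (Fin s → ℝ)}
    (hinv : ∀ v ∈ K, A *ᵥ v ∈ K) (hτ : ∀ k, 1 ≤ k → k ≤ m → tauvec A k ∈ K)
    (hm : 2 * (Module.finrank ℝ K + 1) ≤ m) {i : ℕ} (hi : i ≤ s)
    (hdiag : ∀ j : Fin s, (j : ℕ) < i → A j j ≠ 0 ∨ ∀ k ≤ j, cvec A k ≠ 0) (r : ℝ[X]) :
    polyVec (cvec A) (X ^ 0 * r) ∈ K ⊔ tailSpace s i := by
  induction i generalizing r with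
  | zero => simp [tailSpace_zero]
  | succ i ih =>
    have ih' := ih (by omega) fun j hj => hdiag j (by omega)
    refine polyVec_X_pow_mul_mem_sup_tailSpace_succ hA hinv hτ 0 ⟨i, hi⟩
      (headNodes (cvec A) (i + 1)) (fun j hj => Or.inl (mem_headNodes.2
        ⟨j, Nat.lt_succ_of_le (Fin.le_def.1 hj), rfl⟩)) ?_ ?_ ih' r
    · have h1 := card_headNodes_succ_le (cvec A) ⟨i, hi⟩
      have h2 := card_le_finrank_of_polyVec_mem ih' (headNodes (cvec A) i)
        (fun a => mem_headNodes.1) (Or.inl rfl)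
      simp only at h1
      omega
    · refine (hdiag ⟨i, hi⟩ (Nat.lt_succ_self i)).imp_right fun h h0 => ?_
      obtain ⟨j, hj, hj0⟩ := mem_headNodes.1 h0
      exact h j (Fin.le_def.2 (Nat.lt_succ_iff.1 hj)) hj0

theorem card_nonzero_headNodes_le {s : ℕ} {c : Fin s → ℝ} {K : Submodule ℝ (Fin s → ℝ)} {i : ℕ}
    (h : ∀ r, polyVec c (X ^ 1 * r) ∈ K ⊔ tailSpace s i) :
    ((headNodes c i).erase 0).card ≤ Module.finrank ℝ K :=
  card_le_finrank_of_polyVec_mem h _ (fun _ ha => mem_headNodes.1 (Finset.mem_of_mem_erase ha))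
    (Or.inr (by simp))

/-- A zero node whose unit direction is seen by `K` lowers the bound on the number of nonzero
nodes by one. -/
theorem card_nonzero_headNodes_lt {s : ℕ} {c : Fin s → ℝ} {K : Submodule ℝ (Fin s → ℝ)} {i : ℕ}
    {l : Fin s} (hl : c l = 0) (hli : (l : ℕ) < i) {u : Fin s → ℝ} (hu : u ∈ K) (hul : u l ≠ 0)
    (h : ∀ r, polyVec c (X ^ 1 * r) ∈ K ⊔ tailSpace s i) :
    ((headNodes c i).erase 0).card < Module.finrank ℝ K := by
  let K' : Submodule ℝ (Fin s → ℝ) := K ⊓ LinearMap.ker (LinearMap.proj l)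
  have hK' : K' < K := lt_of_le_of_ne inf_le_left fun e => hul (e.symm ▸ hu : u ∈ K').2
  refine lt_of_le_of_lt (card_nonzero_headNodes_le (K := K') fun r => ?_)
    (Submodule.finrank_lt_finrank_of_lt hK')
  obtain ⟨k, hk, z, hz, hkz⟩ := Submodule.mem_sup.1 (h r)
  refine Submodule.mem_sup.2 ⟨k, ⟨hk, ?_⟩, z, hz, hkz⟩
  have h1 := congrFun hkz l
  simpa [hz l hli, hl] using h1

theorem numAbscissas_le_card_erase {s : ℕ} (A : Matrix (Fin s) (Fin s) ℝ) :
    numAbscissas A ≤ ((headNodes (cvec A) s).erase 0).card + 1 := by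
  rw [← headNodes_self, Finset.card_erase_eq_ite]
  split_ifs <;> omega

theorem numAbscissas_le_finrank_Kspace_add_one {s : ℕ} {A : Matrix (Fin s) (Fin s) ℝ}
    (hA : LowerTriangular A) {m : ℕ} (hm : 2 * (Module.finrank ℝ (Kspace A m) + 1) + 1 ≤ m) :
    numAbscissas A ≤ Module.finrank ℝ (Kspace A m) + 1 := by
  have h := polyVec_X_mul_mem_sup_tailSpace hA (fun v => mulVec_mem_Kspace A m)
    (fun k => tauvec_mem_Kspace A) hm (i₀ := 0) (fun i _ _ => card_nonzero_headNodes_le)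
    (by simp [tailSpace_zero]) (Nat.zero_le s) le_rfl
  exact (numAbscissas_le_card_erase A).trans
    (Nat.add_le_add_right (card_nonzero_headNodes_le h) 1)

theorem numAbscissas_le_finrank_Kspace {s : ℕ} {A : Matrix (Fin s) (Fin s) ℝ}
    (hA : LowerTriangular A) (hG : ¬ GEDIRK A) {m : ℕ}
    (hm : 2 * (Module.finrank ℝ (Kspace A m) + 1) ≤ m) :
    numAbscissas A ≤ Module.finrank ℝ (Kspace A m) := by
  have hinv : ∀ v ∈ Kspace A m, A *ᵥ v ∈ Kspace A m := fun v => mulVec_mem_Kspace A m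
  have hτ : ∀ k, 1 ≤ k → k ≤ m → tauvec A k ∈ Kspace A m := fun k => tauvec_mem_Kspace A
  by_cases hz : ∃ l, cvec A l = 0
  · obtain ⟨l, hl, hmin⟩ : ∃ l, cvec A l = 0 ∧ ∀ j < l, cvec A j ≠ 0 := by
      obtain ⟨l, hl, hmin⟩ := wellFounded_lt.has_min {l | cvec A l = 0} hz
      exact ⟨l, hl, fun j hj h => hmin j h hj⟩
    have hll : A l l ≠ 0 := fun h => hG ⟨l, hl, hmin, h⟩
    have hF := polyVec_mem_sup_tailSpace hA hinv hτ hm (i := l + 1) l.isLt fun j hj => by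
      rcases (Nat.lt_succ_iff.1 hj).lt_or_eq with h | h
      · exact Or.inr fun k hk => hmin k (lt_of_le_of_lt hk h)
      · exact Or.inl (Fin.ext h ▸ hll)
    obtain ⟨u, hu, z, hz, huz⟩ := Submodule.mem_sup.1 (hF 1)
    have hul : u l ≠ 0 := by
      have h1 := congrFun huz l
      rw [Pi.add_apply, hz l (Nat.lt_succ_self _)] at h1
      simp at h1
      simp [h1]
    have hpos : 0 < Module.finrank ℝ (Kspace A m) :=
      Module.finrank_pos_iff_exists_ne_zero.2
        ⟨⟨u, hu⟩, fun h => hul (congrFun (congrArg Subtype.val h) l)⟩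
    obtain ⟨N, hN⟩ := Nat.exists_eq_succ_of_ne_zero hpos.ne'
    have h := polyVec_X_mul_mem_sup_tailSpace hA hinv hτ (N := N) (by omega) (i₀ := l + 1)
      (fun i hi _ h => by
        have := card_nonzero_headNodes_lt hl hi hu hul h
        omega)
      (fun r => by simpa using hF (X * r)) l.isLt le_rfl
    exact (numAbscissas_le_card_erase A).trans (card_nonzero_headNodes_lt hl l.isLt hu hul h)
  · push Not at hz
    have h := polyVec_mem_sup_tailSpace hA hinv hτ hm le_rfl fun j _ => Or.inr fun k _ => hz k
    rw [← headNodes_self]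
    exact card_le_finrank_of_polyVec_mem h _ (fun _ => mem_headNodes.1) (Or.inl rfl)

/-- For a DIRK scheme, for every `m ≥ 1`,
`dim(K_m) ≥ min{⌊(m+κ)/2⌋, n_c} − κ`, with `κ = 1` iff the scheme is a GEDIRK. -/
theorem dirk_dim_K_lower_bound {s : ℕ} (A : Matrix (Fin s) (Fin s) ℝ) (m κ : ℕ)
    (hm : 1 ≤ m) (hdirk : LowerTriangular A)
    (hκ : (κ = 1 ∧ GEDIRK A) ∨ (κ = 0 ∧ ¬ GEDIRK A)) :
    (min ((m + κ) / 2) (numAbscissas A) : ℤ) - κ ≤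
      Module.finrank ℝ (Kspace A m) := by
  rcases hκ with ⟨rfl, -⟩ | ⟨rfl, hG⟩
  · by_cases h : 2 * (Module.finrank ℝ (Kspace A m) + 1) + 1 ≤ m
    · have := numAbscissas_le_finrank_Kspace_add_one hdirk h
      omega
    · omega
  · by_cases h : 2 * (Module.finrank ℝ (Kspace A m) + 1) ≤ m
    · have := numAbscissas_le_finrank_Kspace hdirk hG h
      omega
    · omega

end
end

section
/- Let an s-stage DIRK scheme (A lower triangular) with n_c distinct abscissas have weak stage order at least q with 1 ≤ q ≤ 2n_c − 1, and satisfy bᵀ Aʲ e = 1/(j+1)! for 0 ≤ j ≤ p−1 (p ≥ 1). Then ⌊(q + κ)/2⌋ − κ + p ≤ s + 1 − σ, where σ = 1 if A is invertible and the scheme is stiffly accurate (σ = 0 otherwise), and κ = 1 if the scheme is a GEDIRK (κ = 0 otherwise). -/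
open Matrix Polynomial

noncomputable section

theorem Polynomial.Splits.induction_of_X_sub_C_mul {P : (f : ℝ[X]) → f.Splits → Prop}
    (const : ∀ a, P (C a) (Splits.C a))
    (mul : ∀ r g, ∀ hg : g.Splits, P g hg → P ((X - C r) * g) ((Splits.X_sub_C r).mul hg))
    {f : ℝ[X]} (hf : f.Splits) : P f hf := by
  have key : ∀ (a : ℝ) (m : Multiset ℝ),
      ∃ h : (C a * (m.map (X - C ·)).prod).Splits, P _ h := by
    intro a m
    induction m using Multiset.induction_on with
    | empty => simpa using const a
    | cons r m ih =>
      obtain ⟨h, hP⟩ := ih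
      rw [Multiset.map_cons, Multiset.prod_cons, mul_left_comm]
      exact ⟨_, mul r _ h hP⟩
  obtain ⟨m, hm⟩ := splits_iff_exists_multiset.1 hf
  obtain ⟨h, hP⟩ := key f.leadingCoeff m
  simp only [← hm] at hP
  exact hP

/-- The Laguerre inequality. -/
theorem laguerre_inequality {f : ℝ[X]} (hf : f.Splits) (x : ℝ) :
    0 ≤ f.derivative.eval x ^ 2 - f.eval x * f.derivative.derivative.eval x ∧
      (f.eval x ≠ 0 → f.derivative.eval x ≠ 0 →
        0 < f.derivative.eval x ^ 2 - f.eval x * f.derivative.derivative.eval x) := by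
  induction hf using Splits.induction_of_X_sub_C_mul with
  | const a => simp
  | mul r g hg ih =>
    have key : ((X - C r) * g).derivative.eval x ^ 2 -
        ((X - C r) * g).eval x * ((X - C r) * g).derivative.derivative.eval x =
        g.eval x ^ 2 + (x - r) ^ 2 *
          (g.derivative.eval x ^ 2 - g.eval x * g.derivative.derivative.eval x) := by
      simp
      ring
    rw [key]
    have h := mul_nonneg (sq_nonneg (x - r)) ih.1
    refine ⟨by positivity, fun h0 _ => ?_⟩
    have hgx : g.eval x ≠ 0 := fun hgx => h0 (by simp [hgx])
    have := pow_pos (abs_pos.2 hgx) 2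
    rw [sq_abs] at this
    linarith

theorem im_derivative_mul_conj {f : ℝ[X]} (hf : f.Splits) {z : ℂ} (hz : z.im ≠ 0) :
    z.im * (aeval z f.derivative * starRingEnd ℂ (aeval z f)).im ≤ 0 ∧
      (aeval z f ≠ 0 → aeval z f.derivative ≠ 0 →
        z.im * (aeval z f.derivative * starRingEnd ℂ (aeval z f)).im < 0) := by
  induction hf using Splits.induction_of_X_sub_C_mul with
  | const a => simp
  | mul r g hg ih =>
    have key : z.im * (aeval z ((X - C r) * g).derivative *
          starRingEnd ℂ (aeval z ((X - C r) * g))).im =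
        -(Complex.normSq (aeval z g) * z.im ^ 2) + Complex.normSq (z - r) *
          (z.im * (aeval z g.derivative * starRingEnd ℂ (aeval z g)).im) := by
      simp [Complex.normSq_apply]
      ring
    rw [key]
    have h := mul_nonneg (Complex.normSq_nonneg (z - r)) (neg_nonneg.2 ih.1)
    have h2 := mul_nonneg (Complex.normSq_nonneg (aeval z g)) (sq_nonneg z.im)
    refine ⟨by linarith, fun h0 _ => ?_⟩
    have hgx : aeval z g ≠ 0 := fun hgx => h0 (by simp [hgx])
    have := mul_pos (Complex.normSq_pos.2 hgx) (pow_pos (abs_pos.2 hz) 2)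
    rw [sq_abs] at this
    linarith

theorem Polynomial.Splits.aeval_ne_zero_of_im_ne_zero {f : ℝ[X]} (hf : f.Splits) (h0 : f ≠ 0)
    {z : ℂ} (hz : z.im ≠ 0) : aeval z f ≠ 0 := by
  induction hf using Splits.induction_of_X_sub_C_mul with
  | const a => simpa using h0
  | mul r g hg ih =>
    have hr : z - r ≠ 0 := fun h => hz (by simpa using congrArg Complex.im h)
    simpa using ⟨hr, ih (right_ne_zero_of_mul h0)⟩

/-- The Hermite–Poulain theorem for a linear differential operator. -/
theorem Polynomial.Splits.sub_C_mul_derivative {f : ℝ[X]} (hf : f.Splits) (a : ℝ) :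
    (f - C a * f.derivative).Splits := by
  rcases eq_or_ne f 0 with rfl | hf0
  · simp
  refine Splits.of_splits_map (algebraMap ℝ ℂ) (IsAlgClosed.splits _) fun z hz => ?_
  have hz : aeval z (f - C a * f.derivative) = 0 := by
    rw [aeval_def, ← eval_map]; exact isRoot_of_mem_roots hz
  by_contra hzr
  have him : z.im ≠ 0 := fun h => hzr ⟨z.re, Complex.ext (by simp) (by simp [h])⟩
  have hfz := hf.aeval_ne_zero_of_im_ne_zero hf0 him
  have heq : aeval z f = a * aeval z f.derivative := by
    simpa [sub_eq_zero] using hz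
  have hdz : aeval z f.derivative ≠ 0 := fun h => hfz (by simp [heq, h])
  have := (im_derivative_mul_conj hf him).2 hfz hdz
  rw [heq] at this
  simp only [map_mul, Complex.conj_ofReal, mul_left_comm _ (a : ℂ), Complex.mul_conj] at this
  rw [← Complex.ofReal_mul, Complex.ofReal_im] at this
  simp at this

/-- `∏ₐ (1 - a D) Xⁿ`, with `a` running over the list `l`. -/
def hermitePoulain (n : ℕ) (l : List ℝ) : ℝ[X] :=
  l.foldr (fun a f => f - C a * f.derivative) (X ^ n)

theorem hermitePoulain_cons (n : ℕ) (a : ℝ) (l : List ℝ) :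
    hermitePoulain n (a :: l) =
      hermitePoulain n l - C a * (hermitePoulain n l).derivative := rfl

theorem splits_hermitePoulain (n : ℕ) (l : List ℝ) : (hermitePoulain n l).Splits := by
  induction l with
  | nil => exact Splits.X_pow n
  | cons a l ih => exact ih.sub_C_mul_derivative a

theorem derivative_hermitePoulain_succ (n : ℕ) (l : List ℝ) :
    (hermitePoulain (n + 1) l).derivative = C (n + 1 : ℝ) * hermitePoulain n l := by
  induction l with
  | nil => simp [hermitePoulain]
  | cons a l ih => simp [hermitePoulain_cons, ih, mul_sub, mul_left_comm]

theorem hermitePoulain_eval_derivative_ne_zero {n : ℕ} {l : List ℝ} {x : ℝ} (hx : x ≠ 0)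
    (h0 : (hermitePoulain n l).eval x = 0) : (hermitePoulain n l).derivative.eval x ≠ 0 := by
  induction l with
  | nil => simp [hermitePoulain, hx] at h0
  | cons a l ih =>
    intro h1
    simp only [hermitePoulain_cons, eval_sub, eval_mul, eval_C, derivative_sub, derivative_mul,
      derivative_C, zero_mul, zero_add] at h0 h1
    have hL := (laguerre_inequality (splits_hermitePoulain n l) x).2
    by_cases hf : (hermitePoulain n l).eval x = 0
    · have h2 := ih hf
      rw [hf, zero_sub, neg_eq_zero, mul_eq_zero] at h0
      have ha : a = 0 := h0.resolve_right h2
      simp [ha] at h1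
      exact h2 h1
    · have hd : (hermitePoulain n l).derivative.eval x ≠ 0 := fun h => hf (by simpa [h] using h0)
      have := hL hf hd
      rw [sub_eq_zero] at h0 h1
      rw [h1, h0] at this
      rw [h1] at this
      nlinarith

/-- The linear functional `∑ gᵢ Xⁱ ↦ ∑ gᵢ / (i + m)!`. -/
def invFactorialSum (m : ℕ) : ℝ[X] →ₗ[ℝ] ℝ :=
  Polynomial.lsum fun i => (1 / ((i + m).factorial : ℝ)) • LinearMap.id

theorem invFactorialSum_monomial (m i : ℕ) (a : ℝ) :
    invFactorialSum m (monomial i a) = a / (i + m).factorial := by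
  simp [invFactorialSum, Polynomial.lsum_apply, sum_monomial_index, div_eq_inv_mul]

theorem invFactorialSum_X_mul (m : ℕ) (g : ℝ[X]) :
    invFactorialSum m (X * g) = invFactorialSum (m + 1) g := by
  induction g using Polynomial.induction_on' with
  | add p q hp hq => simp [mul_add, hp, hq]
  | monomial i a =>
    rw [X_mul_monomial, invFactorialSum_monomial, invFactorialSum_monomial, add_right_comm,
      add_assoc]

theorem eval_hermitePoulain (m : ℕ) (l : List ℝ) :
    (hermitePoulain (l.length + m) l).eval 1 =
      (l.length + m).factorial * invFactorialSum m (l.map fun a => X - C a).prod := by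
  induction l generalizing m with
  | nil =>
    have := invFactorialSum_monomial m 0 1
    simp only [monomial_zero_one, zero_add] at this
    simp [hermitePoulain, this, Nat.factorial_ne_zero]
  | cons a l ih =>
    have h1 := ih (m + 1)
    have h2 := ih m
    rw [List.map_cons, List.prod_cons, sub_mul, map_sub, invFactorialSum_X_mul, C_mul', map_smul,
      List.length_cons, add_right_comm, hermitePoulain_cons, derivative_hermitePoulain_succ,
      eval_sub, eval_C_mul, eval_C_mul, h2, add_assoc, h1, ← add_assoc, Nat.factorial_succ]
    push_cast
    rw [smul_eq_mul]
    ring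

/-- A real-rooted polynomial is not annihilated by two consecutive functionals
`∑ gᵢ Xⁱ ↦ ∑ gᵢ / (i + m)!`. -/
theorem invFactorialSum_succ_ne_zero {g : ℝ[X]} (hg : g.Splits) (h0 : g ≠ 0) (m : ℕ)
    (hm : invFactorialSum m g = 0) : invFactorialSum (m + 1) g ≠ 0 := by
  intro hm1
  obtain ⟨M, hM⟩ := splits_iff_exists_multiset.1 hg
  obtain ⟨l, rfl⟩ := Quot.exists_rep M
  have hM : g = C g.leadingCoeff * (l.map fun a => X - C a).prod := by
    simpa using hM
  have hl : g.leadingCoeff ≠ 0 := leadingCoeff_ne_zero.2 h0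
  rw [hM, C_mul', map_smul, smul_eq_mul, mul_eq_zero, or_iff_right hl] at hm hm1
  refine hermitePoulain_eval_derivative_ne_zero (n := l.length + m + 1) (l := l) one_ne_zero ?_ ?_
  · rw [add_assoc, eval_hermitePoulain, hm1, mul_zero]
  · rw [derivative_hermitePoulain_succ, eval_C_mul, eval_hermitePoulain, hm, mul_zero, mul_zero]

/-- `f ↦ A f'(c) - f(c)`. -/
def stageResidual {s : ℕ} (A : Matrix (Fin s) (Fin s) ℝ) : ℝ[X] →ₗ[ℝ] Fin s → ℝ :=
  A.mulVecLin ∘ₗ LinearMap.pi (fun i => leval (cvec A i) ∘ₗ derivative) -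
    LinearMap.pi fun i => leval (cvec A i)

theorem stageResidual_apply {s : ℕ} (A : Matrix (Fin s) (Fin s) ℝ) (f : ℝ[X]) (i : Fin s) :
    stageResidual A f i =
      ∑ j, A i j * f.derivative.eval (cvec A j) - f.eval (cvec A i) := by
  simp [stageResidual, mulVec, dotProduct]

theorem stageResidual_X_pow {s : ℕ} (A : Matrix (Fin s) (Fin s) ℝ) (k : ℕ) :
    stageResidual A (X ^ (k + 1)) = ((k + 1 : ℕ) : ℝ) • tauvec A (k + 1) := by
  ext i
  have hk : ((k : ℝ) + 1) ≠ 0 := by positivity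
  rw [stageResidual_apply]
  simp only [tauvec, mulVec, dotProduct, Pi.smul_apply, Pi.sub_apply, smul_eq_mul, mul_sub,
    Finset.mul_sum, Nat.add_sub_cancel, derivative_X_pow, eval_mul, eval_pow, eval_X, eval_C]
  push_cast
  congr 1
  · exact Finset.sum_congr rfl fun j _ => by ring
  · field_simp

theorem le_finrank_add_card {s : ℕ} (A : Matrix (Fin s) (Fin s) ℝ) {q : ℕ}
    (K : Submodule ℝ (Fin s → ℝ)) (hK : ∀ k, 1 ≤ k → k ≤ q → tauvec A k ∈ K) (T : Finset ℝ)
    (hinj : ∀ f : ℝ[X], f.natDegree ≤ q → f.eval 0 = 0 → stageResidual A f = 0 →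
      (∀ a ∈ T, f.derivative.eval a = 0) → f = 0) :
    q ≤ Module.finrank ℝ K + T.card := by
  let F : (Fin q → ℝ) →ₗ[ℝ] ℝ[X] :=
    Fintype.linearCombination ℝ fun i : Fin q => (X : ℝ[X]) ^ ((i : ℕ) + 1)
  have hF : ∀ v, F v = ∑ i : Fin q, v i • (X : ℝ[X]) ^ ((i : ℕ) + 1) := fun v =>
    Fintype.linearCombination_apply ..
  have hmem : ∀ v, stageResidual A (F v) ∈ K := by
    intro v
    rw [hF, map_sum]
    refine Submodule.sum_mem _ fun i _ => ?_
    rw [map_smul, stageResidual_X_pow]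
    exact K.smul_mem _ (K.smul_mem _ (hK _ (by omega) (by omega)))
  let ψ : (Fin q → ℝ) →ₗ[ℝ] K × (T → ℝ) :=
    ((stageResidual A ∘ₗ F).codRestrict K hmem).prod
      (LinearMap.pi fun a : T => leval (a : ℝ) ∘ₗ derivative ∘ₗ F)
  have hψ : Function.Injective ψ := by
    rw [injective_iff_map_eq_zero]
    intro v hv
    obtain ⟨h1, h2⟩ := Prod.ext_iff.1 hv
    have h0 : F v = 0 := by
      refine hinj _ ?_ ?_ (congrArg Subtype.val h1) fun a ha => congrFun h2 ⟨a, ha⟩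
      · rw [hF]
        exact natDegree_sum_le_of_forall_le _ _ fun i _ =>
          (natDegree_smul_le _ _).trans (by rw [natDegree_X_pow]; omega)
      · simp [hF, eval_finsetSum]
    ext i
    have := congrArg (fun p => p.coeff (i + 1)) h0
    simpa [hF, finsetSum_coeff, coeff_X_pow, Fin.val_inj] using this
  simpa using LinearMap.finrank_le_finrank_of_injective hψ

/-- The distinct abscissas occurring in the first `t` stages. -/
def initialAbscissas {s : ℕ} (A : Matrix (Fin s) (Fin s) ℝ) (t : ℕ) : Finset ℝ :=
  (Finset.univ.filter fun i : Fin s => (i : ℕ) < t).image (cvec A)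

theorem mem_initialAbscissas {s : ℕ} {A : Matrix (Fin s) (Fin s) ℝ} {t : ℕ} {a : ℝ} :
    a ∈ initialAbscissas A t ↔ ∃ i : Fin s, (i : ℕ) < t ∧ cvec A i = a := by
  simp [initialAbscissas]

theorem initialAbscissas_zero {s : ℕ} (A : Matrix (Fin s) (Fin s) ℝ) :
    initialAbscissas A 0 = ∅ := by
  simp [initialAbscissas]

theorem card_initialAbscissas_self {s : ℕ} (A : Matrix (Fin s) (Fin s) ℝ) :
    (initialAbscissas A s).card = numAbscissas A := by
  simp [initialAbscissas, numAbscissas]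

theorem exists_initialAbscissas_succ_subset {s : ℕ} (A : Matrix (Fin s) (Fin s) ℝ) (t : ℕ) :
    ∃ x, initialAbscissas A (t + 1) ⊆ insert x (initialAbscissas A t) := by
  by_cases ht : t < s
  · refine ⟨cvec A ⟨t, ht⟩, fun a ha => ?_⟩
    obtain ⟨i, hi, rfl⟩ := mem_initialAbscissas.1 ha
    rcases Nat.lt_succ_iff_lt_or_eq.1 hi with h | h
    · exact Finset.mem_insert_of_mem (mem_initialAbscissas.2 ⟨i, h, rfl⟩)
    · subst h
      exact Finset.mem_insert_self _ _
  · refine ⟨0, fun a ha => ?_⟩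
    obtain ⟨i, hi, rfl⟩ := mem_initialAbscissas.1 ha
    exact Finset.mem_insert_of_mem (mem_initialAbscissas.2 ⟨i, by omega, rfl⟩)

theorem initialAbscissas_mono {s : ℕ} (A : Matrix (Fin s) (Fin s) ℝ) :
    Monotone (initialAbscissas A) := fun t u h a ha => by
  obtain ⟨i, hi, rfl⟩ := mem_initialAbscissas.1 ha
  exact mem_initialAbscissas.2 ⟨i, by omega, rfl⟩

theorem eq_zero_of_double_roots {f : ℝ[X]} {q : ℕ} (hf : f.natDegree ≤ q) (h0 : f.eval 0 = 0)
    (S : Finset ℝ) (hS : ∀ a ∈ S, f.eval a = 0 ∧ f.derivative.eval a = 0)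
    (hq : q < 2 * S.card + if (0 : ℝ) ∈ S then 0 else 1) : f = 0 := by
  by_contra hne
  have hle : 2 • S.val + (if (0 : ℝ) ∈ S then 0 else {0}) ≤ f.roots := by
    rw [Multiset.le_iff_count]
    intro a
    rw [count_roots]
    by_cases ha : a ∈ S
    · have hmult := (one_lt_rootMultiplicity_iff_isRoot hne).2 (hS a ha)
      have hc : Multiset.count a S.val = 1 := Multiset.count_eq_one_of_mem S.nodup ha
      have hz : Multiset.count a (if (0 : ℝ) ∈ S then 0 else {0}) = 0 := by
        rw [Multiset.count_eq_zero]
        split_ifs with h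
        · simp
        · rw [Multiset.mem_singleton]
          rintro rfl
          exact h ha
      rw [Multiset.count_add, Multiset.count_nsmul, hc, hz]
      omega
    · have hc : Multiset.count a S.val = 0 := Multiset.count_eq_zero_of_notMem ha
      rw [Multiset.count_add, Multiset.count_nsmul, hc]
      split_ifs with h
      · simp
      · rw [Multiset.count_singleton]
        split_ifs with haz
        · subst haz
          have := (rootMultiplicity_pos hne).2 h0
          omega
        · simp
  have hcard := (Multiset.card_le_card hle).trans (card_roots' f)
  have hcs : Multiset.card (if (0 : ℝ) ∈ S then (0 : Multiset ℝ) else {0}) =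
      if (0 : ℝ) ∈ S then 0 else 1 := by
    split_ifs <;> simp
  rw [Multiset.card_add, hcs, Multiset.card_nsmul, Finset.card_val] at hcard
  omega

theorem LowerTriangular.sum_eq {s : ℕ} {A : Matrix (Fin s) (Fin s) ℝ} (hA : LowerTriangular A)
    {v : Fin s → ℝ} {i : Fin s} (hv : ∀ j < i, v j = 0) : ∑ j, A i j * v j = A i i * v i := by
  refine Finset.sum_eq_single i (fun j _ hj => ?_) (by simp)
  rcases lt_or_gt_of_ne hj with h | h
  · rw [hv j h, mul_zero]
  · rw [hA i j h, zero_mul]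

theorem double_roots_of_stageResidual_eq_zero {s : ℕ} {A : Matrix (Fin s) (Fin s) ℝ}
    (hA : LowerTriangular A) {f : ℝ[X]} (h0 : f.eval 0 = 0) (hf : stageResidual A f = 0)
    {t : ℕ} {T : Finset ℝ} (hT : ∀ a ∈ T, f.derivative.eval a = 0)
    (hsub : ∀ a ∈ initialAbscissas A t, a ∉ T → a = 0 ∧ ¬ GEDIRK A) :
    ∀ a ∈ initialAbscissas A t, f.eval a = 0 ∧ f.derivative.eval a = 0 := by
  have hrow : ∀ i, f.eval (cvec A i) = ∑ j, A i j * f.derivative.eval (cvec A j) := fun i => by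
    have := congrFun hf i
    rw [stageResidual_apply, Pi.zero_apply, sub_eq_zero] at this
    exact this.symm
  have hder : ∀ n, ∀ i : Fin s, (i : ℕ) = n → n < t → f.derivative.eval (cvec A i) = 0 := by
    intro n
    induction n using Nat.strong_induction_on with
    | _ n ih =>
      rintro i rfl hi
      by_cases hiT : cvec A i ∈ T
      · exact hT _ hiT
      obtain ⟨hci, hG⟩ := hsub _ (mem_initialAbscissas.2 ⟨i, hi, rfl⟩) hiT
      by_cases hfirst : ∃ j < i, cvec A j = 0
      · obtain ⟨j, hj, hcj⟩ := hfirst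
        have := ih j hj j rfl (lt_trans hj hi)
        rwa [hcj.trans hci.symm] at this
      · push Not at hfirst
        have hd : A i i ≠ 0 := fun h => hG ⟨i, hci, hfirst, h⟩
        have := hrow i
        rw [hA.sum_eq (v := fun j => f.derivative.eval (cvec A j))
          fun j hj => ih j hj j rfl (lt_trans hj hi), hci, h0] at this
        rw [hci]
        exact (mul_eq_zero.1 this.symm).resolve_left hd
  intro a ha
  obtain ⟨i, hi, rfl⟩ := mem_initialAbscissas.1 ha
  have hi0 := hder i i rfl hi
  refine ⟨?_, hi0⟩
  rw [hrow, hA.sum_eq (v := fun j => f.derivative.eval (cvec A j))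
    fun j hj => hder j j rfl (lt_trans hj hi), hi0, mul_zero]

theorem le_finrank_of_not_GEDIRK {s : ℕ} {A : Matrix (Fin s) (Fin s) ℝ}
    (hA : LowerTriangular A) (hG : ¬ GEDIRK A) {q : ℕ} (hq1 : 1 ≤ q)
    (hq2 : q < 2 * numAbscissas A) (K : Submodule ℝ (Fin s → ℝ))
    (hK : ∀ k, 1 ≤ k → k ≤ q → tauvec A k ∈ K) :
    q / 2 ≤ Module.finrank ℝ K := by
  classical
  have hex : ∃ t, q < 2 * (initialAbscissas A t).card +
      if (0 : ℝ) ∈ initialAbscissas A t then 0 else 1 :=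
    ⟨s, by rw [card_initialAbscissas_self]; omega⟩
  obtain ⟨t, ht, hmin⟩ := Nat.findX hex
  have hle := le_finrank_add_card A K hK ((initialAbscissas A t).erase 0)
    fun f hdeg h0 hf hT => eq_zero_of_double_roots hdeg h0 _
      (double_roots_of_stageResidual_eq_zero hA h0 hf hT fun a ha haT =>
        ⟨by_contra fun hne => haT (Finset.mem_erase.2 ⟨hne, ha⟩), hG⟩) ht
  cases t with
  | zero =>
    rw [initialAbscissas_zero] at ht
    simp at ht
    omega
  | succ t =>
    have ht' := hmin t (Nat.lt_succ_self t)
    obtain ⟨x, hx⟩ := exists_initialAbscissas_succ_subset A t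
    have hcard := (Finset.card_le_card hx).trans (Finset.card_insert_le _ _)
    by_cases hz : (0 : ℝ) ∈ initialAbscissas A t
    · have hz' := initialAbscissas_mono A (Nat.le_add_right t 1) hz
      rw [Finset.card_erase_of_mem hz'] at hle
      rw [if_pos hz] at ht'
      omega
    · have := Finset.card_erase_le (s := initialAbscissas A (t + 1)) (a := (0 : ℝ))
      rw [if_neg hz] at ht'
      omega

theorem le_finrank_add_one {s : ℕ} {A : Matrix (Fin s) (Fin s) ℝ}
    (hA : LowerTriangular A) {q : ℕ}
    (hq2 : q < 2 * numAbscissas A) (K : Submodule ℝ (Fin s → ℝ))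
    (hK : ∀ k, 1 ≤ k → k ≤ q → tauvec A k ∈ K) :
    (q + 1) / 2 ≤ Module.finrank ℝ K + 1 := by
  classical
  have hex : ∃ t, q < 2 * (initialAbscissas A t).card :=
    ⟨s, by rw [card_initialAbscissas_self]; omega⟩
  obtain ⟨t, ht, hmin⟩ := Nat.findX hex
  have hle := le_finrank_add_card A K hK (initialAbscissas A t)
    fun f hdeg h0 hf hT => eq_zero_of_double_roots hdeg h0 _
      (double_roots_of_stageResidual_eq_zero hA h0 hf hT fun a ha haT => absurd ha haT)
      (lt_of_lt_of_le ht (Nat.le_add_right _ _))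
  cases t with
  | zero => simp [initialAbscissas_zero] at ht
  | succ t =>
    have ht' := hmin t (Nat.lt_succ_self t)
    obtain ⟨x, hx⟩ := exists_initialAbscissas_succ_subset A t
    have hcard := (Finset.card_le_card hx).trans (Finset.card_insert_le _ _)
    omega

/-- The ideal of polynomials `R` with `bᵀ R(A) = 0`. -/
def leftAnnihilator {s : ℕ} (A : Matrix (Fin s) (Fin s) ℝ) (b : Fin s → ℝ) : Ideal ℝ[X] where
  carrier := {R | b ᵥ* aeval A R = 0}
  add_mem' {P R} hP hR := by
    simp only [Set.mem_ofPred_eq] at hP hR ⊢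
    rw [map_add, vecMul_add, hP, hR, add_zero]
  zero_mem' := by simp
  smul_mem' P R hR := by
    simp only [Set.mem_ofPred_eq] at hR ⊢
    rw [smul_eq_mul, mul_comm, map_mul, ← vecMul_vecMul, hR, zero_vecMul]

theorem mem_leftAnnihilator {s : ℕ} {A : Matrix (Fin s) (Fin s) ℝ} {b : Fin s → ℝ} {R : ℝ[X]} :
    R ∈ leftAnnihilator A b ↔ b ᵥ* aeval A R = 0 := Iff.rfl

theorem charpoly_mem_leftAnnihilator {s : ℕ} (A : Matrix (Fin s) (Fin s) ℝ) (b : Fin s → ℝ) :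
    A.charpoly ∈ leftAnnihilator A b := by
  rw [mem_leftAnnihilator, aeval_self_charpoly, vecMul_zero]

theorem LowerTriangular.splits_charpoly {s : ℕ} {A : Matrix (Fin s) (Fin s) ℝ}
    (hA : LowerTriangular A) : A.charpoly.Splits := by
  have hT : Aᵀ.IsUpperTriangular := fun i j hij => hA j i hij
  rw [← charpoly_transpose, charpoly_of_isUpperTriangular _ hT]
  exact Splits.prod fun i _ => Splits.X_sub_C _

/-- The matrix with rows `bᵀ Aʲ`, `j < d`. -/
def krylov {s : ℕ} (A : Matrix (Fin s) (Fin s) ℝ) (b : Fin s → ℝ) (d : ℕ) :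
    Matrix (Fin d) (Fin s) ℝ :=
  Matrix.of fun j => b ᵥ* A ^ (j : ℕ)

theorem vecMul_aeval_sum {s : ℕ} (A : Matrix (Fin s) (Fin s) ℝ) (b : Fin s → ℝ) {d : ℕ}
    (v : Fin d → ℝ) :
    b ᵥ* aeval A (∑ i : Fin d, v i • (X : ℝ[X]) ^ (i : ℕ)) = ∑ i, v i • b ᵥ* A ^ (i : ℕ) := by
  simp [vecMul_sum, vecMul_smul]

theorem linearIndependent_krylov {s : ℕ} {A : Matrix (Fin s) (Fin s) ℝ} {b : Fin s → ℝ}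
    {g : ℝ[X]} (hg : ∀ R ∈ leftAnnihilator A b, g ∣ R) :
    LinearIndependent ℝ (krylov A b g.natDegree).row := by
  rw [Fintype.linearIndependent_iff]
  intro v hv
  set R : ℝ[X] := ∑ i : Fin g.natDegree, v i • (X : ℝ[X]) ^ (i : ℕ) with hR
  have hmem : R ∈ leftAnnihilator A b := by
    rw [mem_leftAnnihilator, hR, vecMul_aeval_sum]
    exact hv
  have hcoeff : ∀ i : Fin g.natDegree, R.coeff i = v i := fun i => by
    simp [hR, finsetSum_coeff, coeff_X_pow, Fin.val_inj]
  have h0 : R = 0 := by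
    by_contra hne
    have h1 := natDegree_le_of_dvd (hg R hmem) hne
    have h2 : R.natDegree ≤ g.natDegree - 1 := natDegree_sum_le_of_forall_le _ _ fun i _ =>
      (natDegree_smul_le _ _).trans (by rw [natDegree_X_pow]; omega)
    have h3 : g.natDegree = 0 := by omega
    refine hne ?_
    have : IsEmpty (Fin g.natDegree) := by rw [h3]; infer_instance
    rw [hR, Finset.univ_eq_empty, Finset.sum_empty]
  intro i
  rw [← hcoeff, h0, coeff_zero]

theorem finrank_ker_krylov {s : ℕ} {A : Matrix (Fin s) (Fin s) ℝ} {b : Fin s → ℝ} {d : ℕ}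
    (h : LinearIndependent ℝ (krylov A b d).row) :
    d + Module.finrank ℝ (LinearMap.ker (krylov A b d).mulVecLin) = s := by
  have h1 := h.rank_matrix
  have h2 := LinearMap.finrank_range_add_finrank_ker (krylov A b d).mulVecLin
  rw [Matrix.rank] at h1
  simpa [h1] using h2

theorem WSO.mem_ker_krylov {s : ℕ} {A : Matrix (Fin s) (Fin s) ℝ} {b : Fin s → ℝ} {d q : ℕ}
    (h : WSO A b q) (hd : d ≤ s) (k : ℕ) (hk1 : 1 ≤ k) (hkq : k ≤ q) :
    tauvec A k ∈ LinearMap.ker (krylov A b d).mulVecLin := by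
  rw [LinearMap.mem_ker]
  ext j
  have := h j k (by omega) hk1 hkq
  rw [dotProduct_mulVec] at this
  exact this

theorem invFactorialSum_eq_zero {s : ℕ} {A : Matrix (Fin s) (Fin s) ℝ} {b : Fin s → ℝ}
    {g : ℝ[X]} (hg : g ∈ leftAnnihilator A b) (x : Fin s → ℝ) (m : ℕ)
    (hx : ∀ i ≤ g.natDegree, b ⬝ᵥ (A ^ i) *ᵥ x = 1 / (i + m).factorial) :
    invFactorialSum m g = 0 := by
  have h := congrArg (· ⬝ᵥ x) (mem_leftAnnihilator.1 hg)
  simp only [zero_dotProduct] at h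
  rw [← h, ← dotProduct_mulVec]
  conv_lhs => rw [g.as_sum_range]
  rw [aeval_eq_sum_range, map_sum, sum_mulVec, dotProduct_sum]
  refine Finset.sum_congr rfl fun i hi => ?_
  rw [invFactorialSum_monomial, smul_mulVec, dotProduct_smul,
    hx i (by simpa [Nat.lt_succ_iff] using hi), smul_eq_mul, mul_one_div]

theorem order_le_natDegree_add_one {s : ℕ} {A : Matrix (Fin s) (Fin s) ℝ} {b : Fin s → ℝ}
    {g : ℝ[X]} (hg : g ∈ leftAnnihilator A b) (hs : g.Splits) (h0 : g ≠ 0) {p : ℕ}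
    (horder : ∀ j : ℕ, j < p → b ⬝ᵥ (A ^ j) *ᵥ ones s = 1 / (Nat.factorial (j + 1))) :
    p ≤ g.natDegree + 1 := by
  by_contra! hp
  refine invFactorialSum_succ_ne_zero hs h0 1 (invFactorialSum_eq_zero hg (ones s) 1 ?_)
    (invFactorialSum_eq_zero hg (A *ᵥ ones s) 2 ?_)
  · exact fun i hi => horder i (by omega)
  · intro i hi
    rw [mulVec_mulVec, ← pow_succ]
    exact horder (i + 1) (by omega)

theorem StifflyAccurate.order_le_natDegree {s : ℕ} {hs : 0 < s} {A : Matrix (Fin s) (Fin s) ℝ}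
    {b : Fin s → ℝ} (hb : StifflyAccurate hs A b) (hdet : IsUnit A.det)
    {g : ℝ[X]} (hg : g ∈ leftAnnihilator A b) (hsp : g.Splits) (h0 : g ≠ 0) {p : ℕ}
    (horder : ∀ j : ℕ, j < p → b ⬝ᵥ (A ^ j) *ᵥ ones s = 1 / (Nat.factorial (j + 1))) :
    p ≤ g.natDegree := by
  by_contra! hp
  refine invFactorialSum_succ_ne_zero hsp h0 0 (invFactorialSum_eq_zero hg (A⁻¹ *ᵥ ones s) 0 ?_)
    (invFactorialSum_eq_zero hg (ones s) 1 fun i hi => horder i (by omega))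
  intro i hi
  rw [mulVec_mulVec]
  cases i with
  | zero =>
    have hrow : b ⬝ᵥ A⁻¹ *ᵥ ones s = (A *ᵥ A⁻¹ *ᵥ ones s) ⟨s - 1, Nat.sub_lt hs Nat.one_pos⟩ :=
      congrArg (· ⬝ᵥ A⁻¹ *ᵥ ones s) (funext fun j => (hb j).symm)
    rw [pow_zero, one_mul, hrow, mulVec_mulVec, mul_nonsing_inv A hdet, one_mulVec]
    simp [ones]
  | succ i =>
    rw [pow_succ, mul_assoc, mul_nonsing_inv A hdet, mul_one]
    exact horder i (by omega)

/-- Main result for DIRK schemes. For an `s`-stage DIRK scheme of order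
`p ≥ 1` (tall-tree conditions) with weak stage order at least `q`, `1 ≤ q ≤ 2n_c − 1`,
one has `⌊(q+κ)/2⌋ − κ + p ≤ s + 1 − σ`, where `σ = 1` iff `A` is invertible and the scheme
is stiffly accurate, and `κ = 1` iff the scheme is a GEDIRK. -/
theorem main_result_dirk {s : ℕ} (hs : 0 < s) (A : Matrix (Fin s) (Fin s) ℝ)
    (b : Fin s → ℝ) (p q σ κ : ℕ) (hp : 1 ≤ p) (hq1 : 1 ≤ q)
    (hq2 : (q : ℤ) ≤ 2 * (numAbscissas A : ℤ) - 1)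
    (hdirk : LowerTriangular A)
    (hwso : WSO A b q)
    (horder : ∀ j : ℕ, j < p → b ⬝ᵥ (A ^ j).mulVec (ones s) = 1 / (Nat.factorial (j + 1)))
    (hσ : (σ = 1 ∧ StifflyAccurate hs A b ∧ IsUnit A.det) ∨
          (σ = 0 ∧ ¬(StifflyAccurate hs A b ∧ IsUnit A.det)))
    (hκ : (κ = 1 ∧ GEDIRK A) ∨ (κ = 0 ∧ ¬ GEDIRK A)) :
    (q + κ) / 2 - κ + p ≤ s + 1 - σ := by
  set g := Submodule.IsPrincipal.generator (leftAnnihilator A b)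
  have hmem : g ∈ leftAnnihilator A b := Submodule.IsPrincipal.generator_mem _
  have hdvd : ∀ R ∈ leftAnnihilator A b, g ∣ R := fun R hR =>
    (Submodule.IsPrincipal.mem_iff_generator_dvd _).1 hR
  have hchar := hdvd _ (charpoly_mem_leftAnnihilator A b)
  have hchar0 : A.charpoly ≠ 0 := A.charpoly_monic.ne_zero
  have hg0 : g ≠ 0 := ne_zero_of_dvd_ne_zero hchar0 hchar
  have hsp : g.Splits := hdirk.splits_charpoly.of_dvd hchar0 hchar
  have hdim := finrank_ker_krylov (linearIndependent_krylov hdvd)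
  have hK := hwso.mem_ker_krylov (d := g.natDegree) (by omega)
  have hq2' : q < 2 * numAbscissas A := by omega
  have hrank : (q + κ) / 2 - κ ≤
      Module.finrank ℝ (LinearMap.ker (krylov A b g.natDegree).mulVecLin) := by
    rcases hκ with ⟨rfl, -⟩ | ⟨rfl, hG⟩
    · have := le_finrank_add_one hdirk hq2' _ hK
      omega
    · exact le_finrank_of_not_GEDIRK hdirk hG hq1 hq2' _ hK
  rcases hσ with ⟨rfl, hst, hdet⟩ | ⟨rfl, -⟩
  · have := hst.order_le_natDegree hdet hmem hsp hg0 horder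
    omega
  · have := order_le_natDegree_add_one hmem hsp hg0 horder
    omega

end
end

section
/- Let A be lower triangular (a DIRK scheme) and suppose the scheme is not a GEDIRK and has weak stage order at least q for some q ≥ 2. Let P ∈ ℝ[x] be the unique monic polynomial of minimal degree with P(A)·τ^(k) = 0 for k = 2,...,q. If 1 ≤ r ≤ ⌊q/2⌋ and the abscissas c_1, c_2, ..., c_r are pairwise distinct, then the minimal polynomial p_r(x) of the upper-left r×r block [A]_r of A divides P(x). -/
open Matrix Polynomial

noncomputable section

open scoped Nat in
/-- The Vandermonde convolution as an `L Lᵀ` factorisation of the Hankel matrix `(i + j)!`. -/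
lemma factorial_add_eq_sum_choose_mul_choose {i n : ℕ} (hi : i ≤ n) (j : ℕ) :
    (i + j)! = ∑ k ∈ Finset.range (n + 1), (i ! * i.choose k) * (j ! * j.choose k) := by
  have h1 : (j + i).choose i = ∑ k ∈ Finset.range (i + 1), j.choose k * i.choose k := by
    rw [Nat.add_choose_eq, Finset.Nat.sum_antidiagonal_eq_sum_range_succ
      (fun a b => j.choose a * i.choose b)]
    refine Finset.sum_congr rfl fun k hk => ?_
    rw [Nat.choose_symm (Nat.lt_succ_iff.mp (Finset.mem_range.mp hk))]
  have h2 : ∑ k ∈ Finset.range (i + 1), j.choose k * i.choose k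
      = ∑ k ∈ Finset.range (n + 1), j.choose k * i.choose k := by
    refine Finset.sum_subset (Finset.range_mono (by lia)) fun k _ hk => ?_
    rw [Nat.choose_eq_zero_of_lt (n := i) (by simpa [Nat.lt_succ_iff] using hk), mul_zero]
  rw [← Nat.add_choose_mul_factorial_mul_factorial, Nat.add_comm i j, Nat.choose_symm_add,
    h1, h2, Finset.sum_mul, Finset.sum_mul]
  exact Finset.sum_congr rfl fun k _ => by ring

open scoped Nat in
/-- The Hankel form with entries `(i + j)! x ^ (i + j)` is positive at vectors with nonzero last
coordinate, when `x ≠ 0`. -/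
lemma sum_mul_factorial_mul_pow_pos {x : ℝ} (hx : x ≠ 0) (n : ℕ) (f : ℕ → ℝ) (hf : f n ≠ 0) :
    0 < ∑ i ∈ Finset.range (n + 1), ∑ j ∈ Finset.range (n + 1),
      f i * f j * ((i + j)! * x ^ (i + j)) := by
  have key : ∑ i ∈ Finset.range (n + 1), ∑ j ∈ Finset.range (n + 1),
      f i * f j * ((i + j)! * x ^ (i + j)) = ∑ k ∈ Finset.range (n + 1),
        (∑ i ∈ Finset.range (n + 1), f i * x ^ i * (i ! * i.choose k)) ^ 2 := by
    simp_rw [sq, Finset.sum_mul_sum]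
    conv_rhs => rw [Finset.sum_comm]
    refine Finset.sum_congr rfl fun i hi => ?_
    rw [Finset.sum_comm]
    refine Finset.sum_congr rfl fun j _ => ?_
    rw [factorial_add_eq_sum_choose_mul_choose (Nat.lt_succ_iff.mp (Finset.mem_range.mp hi)) j]
    push_cast
    rw [Finset.sum_mul, Finset.mul_sum]
    exact Finset.sum_congr rfl fun k _ => by ring
  rw [key]
  refine Finset.sum_pos' (fun k _ => sq_nonneg _) ⟨n, by simp, ?_⟩
  rw [Finset.sum_range_succ, Finset.sum_eq_zero fun i hi => by
    rw [Nat.choose_eq_zero_of_lt (Finset.mem_range.mp hi)]; simp]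
  have := n.factorial_ne_zero
  simp only [zero_add, Nat.choose_self]
  positivity

/-- Weights on `n` distinct nodes whose moments up to order `2 n` are those of a multiple of an
exponential distribution vanish. -/
lemma eq_zero_of_moments_eq_mul {n : ℕ} {c w : Fin n → ℝ} (hc : Function.Injective c) {x : ℝ}
    (hx : x ≠ 0)
    (hm : ∀ k, 1 ≤ k → k ≤ 2 * n → ∑ i, w i * c i ^ k = k * x * ∑ i, w i * c i ^ (k - 1)) :
    w = 0 := by
  have hmom : ∀ k, k ≤ 2 * n → ∑ i, w i * c i ^ k = (k.factorial * x ^ k) * ∑ i, w i := by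
    intro k
    induction k with
    | zero => simp
    | succ k ih =>
      intro hk
      rw [hm (k + 1) (by lia) hk, Nat.add_sub_cancel, ih (by lia), Nat.factorial_succ]
      push_cast
      ring
  let p : ℝ[X] := ∏ i, (X - C (c i))
  have hmonic : p.Monic := monic_prod_of_monic _ _ fun i _ => monic_X_sub_C _
  have hdeg : p.natDegree = n := by simp [p]
  have hroot : ∀ i, ∑ a ∈ Finset.range (n + 1), p.coeff a * c i ^ a = 0 := by
    intro i
    rw [← eval_eq_sum_range' (by lia), eval_prod]
    exact Finset.prod_eq_zero (Finset.mem_univ i) (by simp)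
  have hpos := sum_mul_factorial_mul_pow_pos hx n p.coeff (by
    have := hmonic.coeff_natDegree
    rw [hdeg] at this
    simp [this])
  have hzero : (∑ a ∈ Finset.range (n + 1), ∑ b ∈ Finset.range (n + 1),
      p.coeff a * p.coeff b * ((a + b).factorial * x ^ (a + b))) * ∑ i, w i = 0 := by
    calc _ = ∑ a ∈ Finset.range (n + 1), ∑ b ∈ Finset.range (n + 1), ∑ i,
          p.coeff a * p.coeff b * (w i * c i ^ (a + b)) := by
          rw [Finset.sum_mul]
          refine Finset.sum_congr rfl fun a ha => ?_
          rw [Finset.sum_mul]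
          refine Finset.sum_congr rfl fun b hb => ?_
          rw [Finset.mem_range] at ha hb
          rw [← Finset.mul_sum, hmom _ (by lia)]
          ring
      _ = ∑ i, w i * ((∑ a ∈ Finset.range (n + 1), p.coeff a * c i ^ a) *
            ∑ b ∈ Finset.range (n + 1), p.coeff b * c i ^ b) := by
          simp_rw [Finset.sum_mul_sum, Finset.mul_sum]
          conv_rhs => rw [Finset.sum_comm]
          refine Finset.sum_congr rfl fun a _ => ?_
          rw [Finset.sum_comm]
          exact Finset.sum_congr rfl fun i _ => Finset.sum_congr rfl fun b _ => by ring
      _ = 0 := by simp [hroot]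
  have hsum : ∑ i, w i = 0 := (mul_eq_zero.mp hzero).resolve_left hpos.ne'
  refine eq_zero_of_forall_pow_sum_mul_pow_eq_zero hc fun k => ?_
  rw [hmom _ (by lia), hsum, mul_zero]

/-- A left eigenvector orthogonal to all stage order residuals up to order `2 n` vanishes. -/
lemma eq_zero_of_vecMul_eq_smul_of_dotProduct_tauvec {n : ℕ} {B : Matrix (Fin n) (Fin n) ℝ}
    (hc : Function.Injective (cvec B)) (hB : ∀ l, cvec B l = 0 → B l l ≠ 0)
    {w : Fin n → ℝ} {x : ℝ} (hw : w ᵥ* B = x • w)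
    (hτ : ∀ k, 2 ≤ k → k ≤ 2 * n → w ⬝ᵥ tauvec B k = 0) : w = 0 := by
  have hτ1 : tauvec B 1 = 0 := by
    have h : ones n = fun _ => 1 := rfl
    ext i
    simp [tauvec, cvec, h]
  have hm : ∀ k, 1 ≤ k → k ≤ 2 * n →
      ∑ i, w i * cvec B i ^ k = k * x * ∑ i, w i * cvec B i ^ (k - 1) := by
    intro k hk1 hk2
    have h : w ⬝ᵥ tauvec B k = 0 := by
      rcases hk1.eq_or_lt with rfl | hk
      · rw [hτ1, dotProduct_zero]
      · exact hτ k hk hk2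
    have hk0 : (k : ℝ) ≠ 0 := by positivity
    rw [tauvec, dotProduct_sub, dotProduct_mulVec, hw, dotProduct_smul, smul_dotProduct,
      sub_eq_zero] at h
    simp only [dotProduct, smul_eq_mul] at h
    rw [mul_assoc, h]
    field_simp
  by_cases hx : x = 0
  · subst hx
    have hwc : (fun i => w i * cvec B i) = 0 := by
      refine eq_zero_of_forall_pow_sum_mul_pow_eq_zero hc fun k => ?_
      have := hm (k + 1) (by lia) (by lia)
      simpa [pow_succ', mul_assoc] using this
    by_contra hne
    obtain ⟨l, hl⟩ := Function.ne_iff.mp hne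
    have hcl : cvec B l = 0 := (mul_eq_zero.mp (congrFun hwc l)).resolve_left hl
    have hother : ∀ j, j ≠ l → w j = 0 := fun j hj =>
      (mul_eq_zero.mp (congrFun hwc j)).resolve_right fun h => hj (hc (h.trans hcl.symm))
    have hrow : ∑ j, w j * B j l = 0 := by
      simpa [vecMul, dotProduct] using congrFun hw l
    rw [Finset.sum_eq_single l (fun j _ hj => by rw [hother j hj, zero_mul]) (by simp)] at hrow
    exact (mul_ne_zero hl (hB l hcl)) hrow
  · exact eq_zero_of_moments_eq_mul hc hx hm

/-- If `P` does not annihilate `a` but `P` times a product of linear factors does, then some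
multiple `Q` of `P` takes values in an eigenspace of `a`. -/
lemma exists_dvd_aeval_ne_zero_of_aeval_mul_prod_eq_zero {K R : Type*} [Field K] [Ring R]
    [Algebra K R] (a : R) (s : Multiset K) (P : K[X]) (hP : aeval a P ≠ 0)
    (hs : aeval a (P * (s.map fun t => X - C t).prod) = 0) :
    ∃ (x : K) (Q : K[X]), P ∣ Q ∧ aeval a Q ≠ 0 ∧ aeval a (Q * (X - C x)) = 0 := by
  induction s using Multiset.induction_on generalizing P with
  | empty => simp_all
  | cons t s ih =>
    by_cases h : aeval a (P * (X - C t)) = 0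
    · exact ⟨t, P, dvd_rfl, hP, h⟩
    · obtain ⟨x, Q, hQ, h1, h2⟩ := ih (P * (X - C t)) h (by simpa [mul_assoc] using hs)
      exact ⟨x, Q, (dvd_mul_right _ _).trans hQ, h1, h2⟩

/-- A polynomial in a lower triangular matrix that annihilates the stage order residuals up to
order `2 n` is zero. -/
lemma aeval_eq_zero_of_mulVec_tauvec {n : ℕ} {B : Matrix (Fin n) (Fin n) ℝ}
    (hlow : LowerTriangular B)
    (hc : Function.Injective (cvec B)) (hB : ∀ l, cvec B l = 0 → B l l ≠ 0)
    {P : ℝ[X]} (hP : ∀ k, 2 ≤ k → k ≤ 2 * n → aeval B P *ᵥ tauvec B k = 0) :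
    aeval B P = 0 := by
  by_contra hne
  have hchar : B.charpoly = ((Finset.univ.val.map fun i => B i i).map fun t => X - C t).prod := by
    have hup : Bᵀ.IsUpperTriangular := fun i j hij => hlow j i hij
    rw [← charpoly_transpose, charpoly_of_isUpperTriangular _ hup, Multiset.map_map]
    rfl
  obtain ⟨x, Q, ⟨R, rfl⟩, hQ, hQx⟩ := exists_dvd_aeval_ne_zero_of_aeval_mul_prod_eq_zero B _ P hne
    (by rw [← hchar, map_mul, aeval_self_charpoly, mul_zero])
  refine hQ (Matrix.ext fun i => congrFun (?_ : (aeval B (P * R)) i = 0))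
  refine eq_zero_of_vecMul_eq_smul_of_dotProduct_tauvec hc hB (x := x) ?_ fun k hk1 hk2 => ?_
  · have h : aeval B (P * R) * B = x • aeval B (P * R) := by
      rw [map_mul (aeval B) (P * R), map_sub, aeval_X, aeval_C, mul_sub, sub_eq_zero] at hQx
      rw [hQx, ← Algebra.commutes, Algebra.smul_def]
    exact congrFun h i
  · have h : aeval B (P * R) *ᵥ tauvec B k = 0 := by
      rw [mul_comm, map_mul, ← mulVec_mulVec, hP k hk1 hk2, mulVec_zero]
    exact congrFun h i

section LeadingBlock

variable {s r : ℕ} {A : Matrix (Fin s) (Fin s) ℝ}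

/-- Restriction to the leading coordinates intertwines a lower triangular matrix with its leading
block. -/
lemma LowerTriangular.mulVec_comp_castLE (hA : LowerTriangular A) (h : r ≤ s) (v : Fin s → ℝ) :
    (A *ᵥ v) ∘ Fin.castLE h =
      A.submatrix (Fin.castLE h) (Fin.castLE h) *ᵥ (v ∘ Fin.castLE h) := by
  ext i
  simp only [Function.comp_apply, mulVec, dotProduct, submatrix_apply]
  refine (Finset.sum_of_injOn (Fin.castLE h) (Fin.castLE_injective h).injOn (by simp)
    (fun j _ hj => ?_) fun _ _ => rfl).symm
  rw [hA, zero_mul]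
  by_contra! hle
  exact hj ⟨⟨j, lt_of_le_of_lt hle i.2⟩, by simp, rfl⟩

lemma LowerTriangular.aeval_mulVec_comp_castLE (hA : LowerTriangular A) (h : r ≤ s) (P : ℝ[X])
    (v : Fin s → ℝ) :
    (aeval A P *ᵥ v) ∘ Fin.castLE h =
      aeval (A.submatrix (Fin.castLE h) (Fin.castLE h)) P *ᵥ (v ∘ Fin.castLE h) := by
  induction P using Polynomial.induction_on' generalizing v with
  | add p q hp hq =>
    rw [map_add, map_add, add_mulVec, add_mulVec, ← hp, ← hq]
    rfl
  | monomial n a =>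
    induction n generalizing v with
    | zero =>
      simp only [monomial_zero_left, aeval_C, Algebra.algebraMap_eq_smul_one, smul_mulVec,
        one_mulVec]
      rfl
    | succ n ih =>
      rw [← monomial_mul_X, map_mul, map_mul, aeval_X, aeval_X, ← mulVec_mulVec,
        ← mulVec_mulVec, ih, hA.mulVec_comp_castLE]

lemma LowerTriangular.cvec_submatrix (hA : LowerTriangular A) (h : r ≤ s) :
    cvec (A.submatrix (Fin.castLE h) (Fin.castLE h)) = cvec A ∘ Fin.castLE h :=
  (hA.mulVec_comp_castLE h (ones s)).symm

lemma LowerTriangular.tauvec_submatrix (hA : LowerTriangular A) (h : r ≤ s) (k : ℕ) :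
    tauvec (A.submatrix (Fin.castLE h) (Fin.castLE h)) k = tauvec A k ∘ Fin.castLE h := by
  have := hA.mulVec_comp_castLE h fun i => cvec A i ^ (k - 1)
  rw [tauvec, hA.cvec_submatrix h]
  simp only [Function.comp_def] at this ⊢
  rw [← this]
  rfl

end LeadingBlock

/-- Let `A` be lower triangular, not a GEDIRK, with weak stage order at
least `q ≥ 2`, and let `P` be the unique monic minimal-degree polynomial with
`P(A)·τ^(k) = 0` for `k = 2,…,q`. If `1 ≤ r ≤ ⌊q/2⌋` and the abscissas `c_1, …, c_r`
are pairwise distinct, then the minimal polynomial of the upper-left `r×r` block of `A`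
divides `P`. -/
theorem block_minpoly_dvd_P {s : ℕ} (A : Matrix (Fin s) (Fin s) ℝ) (b : Fin s → ℝ)
    (q : ℕ) (hq : 2 ≤ q) (hdirk : LowerTriangular A) (hged : ¬ GEDIRK A)
    (hwso : WSO A b q)
    (P : Polynomial ℝ) (hP : PProp A q P)
    (r : ℕ) (hr1 : 1 ≤ r) (hr2 : r ≤ q / 2) (hrs : r ≤ s)
    (hdistinct : ∀ i j : Fin s, (i : ℕ) < r → (j : ℕ) < r → i ≠ j → cvec A i ≠ cvec A j) :
    minpoly ℝ (A.submatrix (Fin.castLE hrs) (Fin.castLE hrs)) ∣ P := by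
  refine minpoly.dvd _ _ (aeval_eq_zero_of_mulVec_tauvec ?_ ?_ ?_ ?_)
  · exact fun i j hij => hdirk _ _ hij
  · intro i j hij
    by_contra hne
    rw [hdirk.cvec_submatrix hrs] at hij
    exact hdistinct _ _ i.2 j.2 (fun h => hne (Fin.castLE_injective hrs h)) hij
  · intro l hl hll
    rw [hdirk.cvec_submatrix hrs] at hl
    refine hged ⟨Fin.castLE hrs l, hl, fun j hj hj0 => ?_, hll⟩
    exact hdistinct j _ (lt_trans hj l.2) l.2 hj.ne (hj0.trans hl.symm)
  · intro k hk1 hk2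
    rw [hdirk.tauvec_submatrix hrs, ← hdirk.aeval_mulVec_comp_castLE hrs,
      hP.2.1 k hk1 (by lia)]
    rfl

end
end

section
/- For integers n ≥ 1 and m ≥ 0, let H_n(m) ∈ ℝ^{n×n} be the Hankel matrix with entries (H_n(m))_{ij} = 1/(m + i + j − 2)! for 1 ≤ i, j ≤ n. Then det H_n(m) = σ(n) · c(n) · c(m + n − 1) / c(m + 2n − 1), where c(k) := ∏_{i=1}^{k−1} i! (an empty product, equal to 1, when k ≤ 1), and σ(n) = 1 if n ≡ 0 or 1 (mod 4) and σ(n) = −1 if n ≡ 2 or 3 (mod 4). In particular, det H_n(m) ≠ 0 for all n ≥ 1 and m ≥ 0. -/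
open Matrix Polynomial

noncomputable section

/-- `c(k) := ∏_{i=1}^{k−1} i!` (so `c(k) = 1` for `k ≤ 1`). -/
def superfactorial (k : ℕ) : ℝ := ∏ i ∈ Finset.Icc 1 (k - 1), (Nat.factorial i : ℝ)

/-- `σ(n) = 1` if `n ≡ 0, 1 (mod 4)`, and `σ(n) = −1` if `n ≡ 2, 3 (mod 4)`. -/
def hankelSign (n : ℕ) : ℝ := if n % 4 = 0 ∨ n % 4 = 1 then 1 else -1

theorem Fin.sign_revPerm (n : ℕ) :
    Equiv.Perm.sign (Fin.revPerm : Equiv.Perm (Fin n)) = (-1) ^ ∑ i ∈ Finset.range n, i := by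
  rw [Equiv.Perm.sign_eq_prod_prod_Iio, ← Fin.sum_univ_eq_sum_range (fun i => i) n,
    ← Finset.prod_pow_eq_pow_sum]
  refine Finset.prod_congr rfl fun j _ => ?_
  rw [Finset.prod_congr rfl (g := fun _ => -1), Finset.prod_const, Fin.card_Iio]
  intro i hi
  simp [(Finset.mem_Iio.mp hi).le]

theorem superfactorial_eq_prod_range (k : ℕ) :
    superfactorial k = ∏ i ∈ Finset.range k, (Nat.factorial i : ℝ) := by
  cases k with
  | zero => simp [superfactorial]
  | succ k =>
    rw [superfactorial, Nat.add_sub_cancel, ← Nat.cast_prod, ← Nat.cast_prod,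
      Nat.prod_Icc_factorial, Nat.prod_range_succ_factorial]

theorem superfactorial_pos (k : ℕ) : 0 < superfactorial k :=
  Finset.prod_pos fun i _ => by positivity

theorem superfactorial_add (a b : ℕ) :
    superfactorial (a + b) = superfactorial a * ∏ i : Fin b, (Nat.factorial (a + i) : ℝ) := by
  rw [superfactorial_eq_prod_range, superfactorial_eq_prod_range, Finset.prod_range_add,
    Fin.prod_univ_eq_prod_range (fun i => (Nat.factorial (a + i) : ℝ)) b]

theorem hankelSign_ne_zero (n : ℕ) : hankelSign n ≠ 0 := by
  unfold hankelSign
  split_ifs <;> norm_num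

theorem hankelSign_succ (n : ℕ) : hankelSign (n + 1) = hankelSign n * (-1) ^ n := by
  have h_pow : ((-1 : ℝ) ^ 4) ^ (n / 4) = 1 := by norm_num
  obtain h | h | h | h : n % 4 = 0 ∨ n % 4 = 1 ∨ n % 4 = 2 ∨ n % 4 = 3 := by omega
  all_goals
    rw [← Nat.div_add_mod n 4, h]
    rw [pow_add, pow_mul, h_pow]
    norm_num [hankelSign, Nat.add_mod]

theorem hankelSign_eq_neg_one_pow (n : ℕ) :
    hankelSign n = (-1) ^ ∑ i ∈ Finset.range n, i := by
  induction n with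
  | zero => simp [hankelSign]
  | succ n ih => rw [hankelSign_succ, ih, Finset.sum_range_succ, pow_add]

theorem det_one_div_factorial_add_sub (k m : ℕ) :
    Matrix.det (Matrix.of fun i j : Fin (k + 1) =>
        (1 : ℝ) / (Nat.factorial (m + (i : ℕ) + (k - (j : ℕ))))) =
      (∏ i : Fin (k + 1), ((Nat.factorial (m + k + i) : ℝ))⁻¹) * superfactorial (k + 1) := by
  have vandermonde_det :
      (Matrix.of fun i j : Fin (k + 1) =>
        (descPochhammer ℝ j).eval ((i : ℝ) + ((m + k : ℕ) : ℝ))).det =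
        superfactorial (k + 1) := by
    rw [← Matrix.det_eval_matrixOfPolynomials_eq_det_vandermonde
        (fun i : Fin (k + 1) => (i : ℝ) + ((m + k : ℕ) : ℝ))
        (fun j => descPochhammer ℝ j) (fun j => descPochhammer_natDegree ℝ j)
        (fun j => monic_descPochhammer ℝ j),
      Matrix.det_vandermonde_add, Matrix.det_vandermonde_id_eq_superFactorial,
      superfactorial, Nat.add_sub_cancel, ← Nat.cast_prod, Nat.prod_Icc_factorial]
  rw [← vandermonde_det, ← Matrix.det_mul_column]
  congr 1
  ext i j
  have hj : (j : ℕ) ≤ k := Nat.lt_succ_iff.mp j.isLt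
  simp only [Matrix.of_apply]
  rw [← Nat.cast_add, descPochhammer_eval_eq_descFactorial,
    show (i : ℕ) + (m + k) = m + k + i by ring,
    ← Nat.factorial_mul_descFactorial (show (j : ℕ) ≤ m + k + i by omega),
    show m + k + (i : ℕ) - j = m + i + (k - j) by omega]
  have hdesc : ((m + k + (i : ℕ)).descFactorial j : ℝ) ≠ 0 := by
    rw [Nat.cast_ne_zero, Ne, Nat.descFactorial_eq_zero_iff_lt]
    omega
  push_cast
  field_simp

/-- The Hankel matrix `H_n(m)` with entries `1/(m+i+j−2)!`
(`1 ≤ i,j ≤ n`) has determinant `σ(n)·c(n)·c(m+n−1)/c(m+2n−1)`; in particular it is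
nonsingular. -/
theorem hankel_det (n m : ℕ) (hn : 1 ≤ n) :
    (Matrix.det (Matrix.of fun i j : Fin n =>
        (1 : ℝ) / (Nat.factorial (m + (i : ℕ) + (j : ℕ))))
      = hankelSign n * superfactorial n * superfactorial (m + n - 1) /
        superfactorial (m + 2 * n - 1)) ∧
    (Matrix.det (Matrix.of fun i j : Fin n =>
        (1 : ℝ) / (Nat.factorial (m + (i : ℕ) + (j : ℕ)))) ≠ 0) := by
  obtain ⟨k, rfl⟩ : ∃ k, n = k + 1 := ⟨n - 1, by omega⟩
  have hdet : Matrix.det (Matrix.of fun i j : Fin (k + 1) =>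
        (1 : ℝ) / (Nat.factorial (m + (i : ℕ) + (j : ℕ))))
      = hankelSign (k + 1) * superfactorial (k + 1) * superfactorial (m + (k + 1) - 1) /
        superfactorial (m + 2 * (k + 1) - 1) := by
    have hrev := Matrix.det_permute' (Fin.revPerm : Equiv.Perm (Fin (k + 1)))
      (Matrix.of fun i j : Fin (k + 1) =>
        (1 : ℝ) / (Nat.factorial (m + (i : ℕ) + (k - (j : ℕ)))))
    have hsub : (Matrix.of fun i j : Fin (k + 1) =>
        (1 : ℝ) / (Nat.factorial (m + (i : ℕ) + (k - (j : ℕ))))).submatrix id Fin.revPerm =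
        Matrix.of fun i j : Fin (k + 1) =>
          (1 : ℝ) / (Nat.factorial (m + (i : ℕ) + (j : ℕ))) := by
      ext i j
      have hj : k - (k - (j : ℕ)) = j := by omega
      simp [hj]
    have hsign : ((Equiv.Perm.sign (Fin.revPerm : Equiv.Perm (Fin (k + 1))) : ℤ) : ℝ) =
        hankelSign (k + 1) := by
      rw [Fin.sign_revPerm, hankelSign_eq_neg_one_pow]
      push_cast
      rfl
    rw [hsub, hsign, det_one_div_factorial_add_sub] at hrev
    rw [hrev, show m + 2 * (k + 1) - 1 = m + k + (k + 1) by omega,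
      show m + (k + 1) - 1 = m + k by omega, superfactorial_add (m + k) (k + 1),
      Finset.prod_inv_distrib]
    have hsf := (superfactorial_pos (m + k)).ne'
    field_simp
  refine ⟨hdet, ?_⟩
  rw [hdet]
  exact div_ne_zero (mul_ne_zero (mul_ne_zero (hankelSign_ne_zero _) (superfactorial_pos _).ne')
    (superfactorial_pos _).ne') (superfactorial_pos _).ne'

end
end
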